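/- arXiv:1112.0147 — 6 statements merged into one kernel-verified Lean document; each statement's English description precedes it below -/
import Mathlib

section
/- Let λ be a σ-finite measure on a measurable space X, let E be a complex Banach space, let m, n ∈ ℕ, and let f : (Fin m → X) × (Fin n → X) → E be Bochner integrable with respect to λ^{⊗m} ⊗ λ^{⊗n}. Then for every subset S ⊆ Fin (m+n) with |S| = m one has ∫ f(x|_S, x|_{S^c}) dλ^{⊗(m+n)}(x) = ∫ f d(λ^{⊗m} ⊗ λ^{⊗n}), and consequently ∑_{S ⊆ Fin(m+n), |S| = m} ∫ f(x|_S, x|_{S^c}) dλ^{⊗(m+n)}(x) = (m+n choose m) · ∫ f d(λ^{⊗m} ⊗ λ^{⊗n}). (This is the per-degree form of the principal formula of multiple integration ∫ ∑_{υ⊆ϑ} f(υ, ϑ∖υ) dϑ = ∬ f(υ,κ) dυ dκ.) -/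
open MeasureTheory ENNReal

noncomputable section

/-- Restriction of `x : Fin n → X` to a subset `S` of cardinality `m`,
coordinates taken in increasing index order. -/
def restrOf {X : Type*} {n m : ℕ} (S : Finset (Fin n)) (hS : S.card = m) (x : Fin n → X) :
    Fin m → X := fun i => x (S.orderIsoOfFin hS i)

/-- The map `x ↦ (x|_S, x|_{Sᶜ})` as a measurable equivalence. -/
def restrEquiv (X : Type*) [MeasurableSpace X] {k m n : ℕ} (S : Finset (Fin k))
    (hS : S.card = m) (hS' : Sᶜ.card = n) : (Fin k → X) ≃ᵐ (Fin m → X) × (Fin n → X) :=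
  (MeasurableEquiv.piCongrLeft (fun _ : Fin k => X) (finSumEquivOfFinset hS hS')).symm.trans
    (MeasurableEquiv.sumPiEquivProdPi fun _ : Fin m ⊕ Fin n => X)

theorem restrEquiv_apply {X : Type*} [MeasurableSpace X] {k m n : ℕ} (S : Finset (Fin k))
    (hS : S.card = m) (hS' : Sᶜ.card = n) (x : Fin k → X) :
    restrEquiv X S hS hS' x = (restrOf S hS x, restrOf Sᶜ hS' x) :=
  rfl

theorem measurePreserving_restrEquiv {X : Type*} [MeasurableSpace X] (μ : Measure X)
    [SigmaFinite μ] {k m n : ℕ} (S : Finset (Fin k)) (hS : S.card = m) (hS' : Sᶜ.card = n) :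
    MeasurePreserving (restrEquiv X S hS hS') (Measure.pi fun _ : Fin k => μ)
      ((Measure.pi fun _ : Fin m => μ).prod (Measure.pi fun _ : Fin n => μ)) :=
  (measurePreserving_sumPiEquivProdPi fun _ : Fin m ⊕ Fin n => μ).comp
    ((measurePreserving_piCongrLeft (fun _ : Fin k => μ) (finSumEquivOfFinset hS hS')).symm _)

theorem integral_restrOf_restrOf_compl {X : Type*} [MeasurableSpace X] (μ : Measure X)
    [SigmaFinite μ] {E : Type*} [NormedAddCommGroup E] [NormedSpace ℝ E] {k m n : ℕ}
    (f : ((Fin m → X) × (Fin n → X)) → E) (S : Finset (Fin k)) (hS : S.card = m)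
    (hS' : Sᶜ.card = n) :
    ∫ x, f (restrOf S hS x, restrOf Sᶜ hS' x) ∂(Measure.pi fun _ : Fin k => μ)
      = ∫ p, f p ∂((Measure.pi fun _ : Fin m => μ).prod (Measure.pi fun _ : Fin n => μ)) := by
  simp_rw [← restrEquiv_apply]
  exact (measurePreserving_restrEquiv μ S hS hS').integral_comp' f

/-- The per-degree form of the principal formula of multiple integration:
for integrable `f` and any `S ⊆ Fin (m+n)` with `|S| = m`,
`∫ f(x|_S, x|_{Sᶜ}) dλ^{⊗(m+n)} = ∫ f d(λ^{⊗m} ⊗ λ^{⊗n})`, and summing over all such `S`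
gives `(m+n choose m)` times the right-hand side. -/
theorem stmt0 {X : Type*} [MeasurableSpace X] (lam : Measure X) [SigmaFinite lam]
    {E : Type*} [NormedAddCommGroup E] [NormedSpace ℂ E] [CompleteSpace E]
    (m n : ℕ) (f : ((Fin m → X) × (Fin n → X)) → E)
    (hf : Integrable f
      ((Measure.pi fun _ : Fin m => lam).prod (Measure.pi fun _ : Fin n => lam))) :
    (∀ (S : Finset (Fin (m + n))) (hS : S.card = m),
      ∫ x, f (restrOf S hS x,
              restrOf Sᶜ (by simp [Finset.card_compl, hS]) x)
          ∂(Measure.pi fun _ : Fin (m + n) => lam)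
        = ∫ p, f p ∂((Measure.pi fun _ : Fin m => lam).prod (Measure.pi fun _ : Fin n => lam)))
    ∧
    (∑ S ∈ ((Finset.univ : Finset (Finset (Fin (m + n)))).filter fun S => S.card = m).attach,
        ∫ x, f (restrOf S.1 (Finset.mem_filter.mp S.2).2 x,
                restrOf S.1ᶜ (by simp [Finset.card_compl, (Finset.mem_filter.mp S.2).2]) x)
            ∂(Measure.pi fun _ : Fin (m + n) => lam)
      = ((m + n).choose m) •
          ∫ p, f p ∂((Measure.pi fun _ : Fin m => lam).prod (Measure.pi fun _ : Fin n => lam))) := by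
  refine ⟨fun S hS => integral_restrOf_restrOf_compl lam f S hS _, ?_⟩
  rw [Finset.sum_congr rfl fun S _ => integral_restrOf_restrOf_compl lam f S.1 _ _,
    Finset.sum_const, Finset.card_attach, Finset.univ_filter_card_eq, Finset.card_powersetCard,
    Finset.card_univ, Fintype.card_fin]
end
end

section
/- Let f : Ω × Ω → E be Bochner integrable with respect to μ ⊗ μ. Then the function (n, x) ↦ ∑_{S ⊆ Fin n} f((|S|, x|_S), (n − |S|, x|_{S^c})) is μ-integrable on Ω and ∫_Ω ∑_{S ⊆ Fin n} f((|S|, x|_S), (n − |S|, x|_{S^c})) dμ(n, x) = ∫_{Ω × Ω} f d(μ ⊗ μ). (This is the principal formula of multiple integration on the Guichardet space, ∫ ∑_{υ⊆ϑ} f(υ, ϑ∖υ) dϑ = ∬ f(υ,κ) dυ dκ.) -/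
open MeasureTheory ENNReal

noncomputable section

/-- The Guichardet space over `X`. -/
abbrev GS (X : Type*) := Σ n : ℕ, Fin n → X

/-- The Guichardet measure `μ = ∑ₙ (1/n!)·(Sigma.mk n)_* λ^{⊗n}`. -/
def guichardetMeasure {X : Type*} [MeasurableSpace X] (lam : Measure X) : Measure (GS X) :=
  Measure.sum fun n =>
    ((n.factorial : ℝ≥0∞))⁻¹ • Measure.map (Sigma.mk n) (Measure.pi fun _ : Fin n => lam)

lemma measurable_sigmaMk {ι : Type*} {β : ι → Type*} [∀ i, MeasurableSpace (β i)] (i : ι) :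
    Measurable (Sigma.mk i : β i → Sigma β) :=
  measurable_iff_le_map.2 (iInf_le _ i)

lemma measurableEmbedding_sigmaMk {ι : Type*} {β : ι → Type*} [∀ i, MeasurableSpace (β i)]
    (i : ι) : MeasurableEmbedding (Sigma.mk i : β i → Sigma β) where
  injective := sigma_mk_injective
  measurable := measurable_sigmaMk i
  measurableSet_image' := fun {s} hs ↦ by
    refine MeasurableSpace.measurableSet_iInf.2 fun j ↦ ?_
    change MeasurableSet (Sigma.mk j ⁻¹' (Sigma.mk i '' s))
    by_cases hij : j = i
    · subst hij
      rwa [Set.preimage_image_eq _ sigma_mk_injective]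
    · rw [Set.preimage_image_sigmaMk_of_ne hij]
      exact MeasurableSet.empty

/-- Splitting the coordinates of a point of `Fin n → X` along a subset of `Fin n`
carries the product measure to a product of product measures. -/
lemma measurePreserving_restrOf_prod {X : Type*} [MeasurableSpace X] (lam : Measure X)
    [SigmaFinite lam] {n m k : ℕ} (S : Finset (Fin n)) (hm : S.card = m) (hk : Sᶜ.card = k) :
    MeasurePreserving (fun x : Fin n → X ↦ (restrOf S hm x, restrOf Sᶜ hk x))
      (Measure.pi fun _ ↦ lam)
      ((Measure.pi fun _ : Fin m ↦ lam).prod (Measure.pi fun _ : Fin k ↦ lam)) :=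
  (measurePreserving_sumPiEquivProdPi fun _ : Fin m ⊕ Fin k ↦ lam).comp
    (measurePreserving_piCongrLeft (fun _ ↦ lam) (finSumEquivOfFinset hm hk)).symm

/-- The pair of points of the Guichardet space obtained by splitting `x` along `S`. -/
def splitAt {X : Type*} {n : ℕ} (S : Finset (Fin n)) (x : Fin n → X) : GS X × GS X :=
  (⟨S.card, restrOf S rfl x⟩, ⟨n - S.card, restrOf Sᶜ (by simp [Finset.card_compl]) x⟩)

/-- The part of the product of two Guichardet measures living on pairs of an `m`-point and a
`k`-point configuration, without its normalisation. -/
def levelMeasure {X : Type*} [MeasurableSpace X] (lam : Measure X) (m k : ℕ) :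
    Measure (GS X × GS X) :=
  ((Measure.pi fun _ : Fin m ↦ lam).prod (Measure.pi fun _ : Fin k ↦ lam)).map
    (Prod.map (Sigma.mk m) (Sigma.mk k))

section

variable {X : Type*} [MeasurableSpace X] (lam : Measure X) [SigmaFinite lam]

lemma measurePreserving_splitAt {n : ℕ} (S : Finset (Fin n)) :
    MeasurePreserving (splitAt (X := X) S) (Measure.pi fun _ ↦ lam)
      (levelMeasure lam S.card (n - S.card)) := by
  have hk : Sᶜ.card = n - S.card := by simp [Finset.card_compl]
  have h : MeasurePreserving (Prod.map (Sigma.mk S.card) (Sigma.mk (n - S.card)))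
      _ (levelMeasure lam S.card (n - S.card)) :=
    ((measurable_sigmaMk _).prodMap (measurable_sigmaMk _)).measurePreserving _
  exact h.comp (measurePreserving_restrOf_prod lam S rfl hk)

lemma guichardetMeasure_prod_self :
    (guichardetMeasure lam).prod (guichardetMeasure lam) =
      Measure.sum fun p : ℕ × ℕ ↦
        ((p.1.factorial : ℝ≥0∞)⁻¹ * (p.2.factorial : ℝ≥0∞)⁻¹) • levelMeasure lam p.1 p.2 := by
  have (n : ℕ) : SFinite (Measure.map (Sigma.mk n : _ → GS X)
    (Measure.pi fun _ : Fin n ↦ lam)) := inferInstance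
  rw [guichardetMeasure, Measure.prod_sum]
  congr 1 with p : 1
  rw [Measure.prod_smul_left, Measure.prod_smul_right,
    Measure.map_prod_map _ _ (measurable_sigmaMk _) (measurable_sigmaMk _), smul_smul]
  rfl

lemma inv_factorial_mul_choose {n m k : ℕ} (h : m + k = n) :
    (n.factorial : ℝ≥0∞)⁻¹ * (n.choose m : ℝ≥0∞) =
      (m.factorial : ℝ≥0∞)⁻¹ * (k.factorial : ℝ≥0∞)⁻¹ := by
  have hfac (i : ℕ) : (i.factorial : ℝ≥0∞) ≠ 0 := by exact_mod_cast i.factorial_ne_zero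
  have htop (i : ℕ) : (i.factorial : ℝ≥0∞) ≠ ∞ := ENNReal.natCast_ne_top _
  rw [← ENNReal.mul_inv (.inl (hfac m)) (.inl (htop m))]
  refine ENNReal.eq_inv_of_mul_eq_one_left ?_
  subst h
  rw [mul_assoc, ← mul_assoc ((m + k).choose m : ℝ≥0∞), ← Nat.cast_mul, ← Nat.cast_mul,
    Nat.choose_symm_add, Nat.add_choose_mul_factorial_mul_factorial,
    ENNReal.inv_mul_cancel (hfac _) (htop _)]

/-- The product of two Guichardet measures, decomposed by the total number of points. -/
lemma guichardetMeasure_prod_self_eq_sum_splitAt :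
    (guichardetMeasure lam).prod (guichardetMeasure lam) =
      Measure.sum fun n : ℕ ↦ (n.factorial : ℝ≥0∞)⁻¹ •
        ∑ S : Finset (Fin n), (Measure.pi fun _ ↦ lam).map (splitAt (X := X) S) := by
  rw [guichardetMeasure_prod_self]
  ext s hs
  rw [Measure.sum_apply _ hs, Measure.sum_apply _ hs,
    ← Finset.HasAntidiagonal.sigmaAntidiagonalEquivProd.tsum_eq, ENNReal.tsum_sigma']
  congr 1 with n
  simp only [(measurePreserving_splitAt lam _).map_eq]
  rw [tsum_fintype, ← Finset.powerset_univ,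
    Finset.sum_powerset_apply_card (fun j ↦ levelMeasure lam j (n - j)), Finset.card_univ,
    Fintype.card_fin, Measure.smul_apply, Measure.finsetSum_apply, smul_eq_mul, Finset.mul_sum]
  refine (Finset.sum_coe_sort (Finset.HasAntidiagonal.antidiagonal n) (fun p ↦
      (((p.1.factorial : ℝ≥0∞)⁻¹ * (p.2.factorial : ℝ≥0∞)⁻¹) • levelMeasure lam p.1 p.2)
        s)).trans ?_
  rw [Finset.Nat.sum_antidiagonal_eq_sum_range_succ_mk]
  refine Finset.sum_congr rfl fun j hj ↦ ?_
  have hj' : j + (n - j) = n := by have := Finset.mem_range.1 hj; omega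
  simp only [Measure.smul_apply, nsmul_eq_mul, smul_eq_mul, ← inv_factorial_mul_choose hj',
    mul_assoc]

variable {E : Type*} [NormedAddCommGroup E] {n : ℕ} {f : GS X × GS X → E} {c : ℝ≥0∞}

lemma integrable_comp_splitAt
    (hf : Integrable f (∑ S : Finset (Fin n), (Measure.pi fun _ ↦ lam).map (splitAt S)))
    (S : Finset (Fin n)) : Integrable (fun x ↦ f (splitAt S x)) (Measure.pi fun _ ↦ lam) :=
  (integrable_finsetSum_measure.1 hf S (Finset.mem_univ S)).comp_measurable
    (measurePreserving_splitAt lam S).measurable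

lemma integrable_sum_splitAt (hc : c ≠ 0) (hc' : c ≠ ∞)
    (hf : Integrable f (c • ∑ S : Finset (Fin n), (Measure.pi fun _ ↦ lam).map (splitAt S))) :
    Integrable (fun ϑ : GS X ↦ ∑ S : Finset (Fin ϑ.1), f (splitAt S ϑ.2))
      (c • (Measure.pi fun _ : Fin n ↦ lam).map (Sigma.mk n)) := by
  rw [integrable_smul_measure hc hc'] at hf ⊢
  rw [(measurableEmbedding_sigmaMk n).integrable_map_iff]
  exact integrable_finsetSum (Finset.univ : Finset (Finset (Fin n)))
    fun S _ ↦ integrable_comp_splitAt lam hf S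

lemma integral_sum_splitAt [NormedSpace ℝ E] (hc : c ≠ 0) (hc' : c ≠ ∞)
    (hf : Integrable f (c • ∑ S : Finset (Fin n), (Measure.pi fun _ ↦ lam).map (splitAt S))) :
    ∫ ϑ : GS X, ∑ S : Finset (Fin ϑ.1), f (splitAt S ϑ.2)
        ∂(c • (Measure.pi fun _ : Fin n ↦ lam).map (Sigma.mk n)) =
      ∫ p, f p ∂(c • ∑ S : Finset (Fin n), (Measure.pi fun _ ↦ lam).map (splitAt S)) := by
  rw [integrable_smul_measure hc hc'] at hf
  have hS := integrable_finsetSum_measure.1 hf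
  rw [integral_smul_measure, integral_smul_measure, (measurableEmbedding_sigmaMk n).integral_map,
    integral_finsetSum (Finset.univ : Finset (Finset (Fin n)))
      fun S _ ↦ integrable_comp_splitAt lam hf S,
    integral_finsetSum_measure hS]
  congr 1
  refine Finset.sum_congr rfl fun S hS' ↦ ?_
  rw [integral_map (measurePreserving_splitAt lam S).measurable.aemeasurable
    (hS S hS').aestronglyMeasurable]

lemma integral_norm_sum_splitAt_le (hc : c ≠ 0) (hc' : c ≠ ∞)
    (hf : Integrable f (c • ∑ S : Finset (Fin n), (Measure.pi fun _ ↦ lam).map (splitAt S))) :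
    ∫ ϑ : GS X, ‖∑ S : Finset (Fin ϑ.1), f (splitAt S ϑ.2)‖
        ∂(c • (Measure.pi fun _ : Fin n ↦ lam).map (Sigma.mk n)) ≤
      ∫ p, ‖f p‖ ∂(c • ∑ S : Finset (Fin n), (Measure.pi fun _ ↦ lam).map (splitAt S)) := by
  have hint := integrable_sum_splitAt lam hc hc' hf.norm
  have heq := integral_sum_splitAt lam hc hc' hf.norm
  rw [← heq]
  exact integral_mono (integrable_sum_splitAt lam hc hc' hf).norm hint
    fun ϑ ↦ norm_sum_le Finset.univ fun S ↦ f (splitAt S ϑ.2)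

end

/-- The principal formula of multiple integration on the Guichardet space:
`∫ ∑_{υ⊆ϑ} f(υ, ϑ∖υ) dϑ = ∬ f(υ,κ) dυ dκ`. -/
theorem stmt1 {X : Type*} [MeasurableSpace X] (lam : Measure X) [SigmaFinite lam]
    {E : Type*} [NormedAddCommGroup E] [NormedSpace ℂ E] [CompleteSpace E]
    (f : GS X × GS X → E)
    (hf : Integrable f ((guichardetMeasure lam).prod (guichardetMeasure lam))) :
    Integrable (fun ϑ : GS X => ∑ S : Finset (Fin ϑ.1),
        f (⟨S.card, restrOf S rfl ϑ.2⟩,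
           ⟨ϑ.1 - S.card, restrOf Sᶜ (by simp [Finset.card_compl]) ϑ.2⟩))
      (guichardetMeasure lam)
    ∧
    ∫ ϑ : GS X, ∑ S : Finset (Fin ϑ.1),
        f (⟨S.card, restrOf S rfl ϑ.2⟩,
           ⟨ϑ.1 - S.card, restrOf Sᶜ (by simp [Finset.card_compl]) ϑ.2⟩)
      ∂(guichardetMeasure lam)
      = ∫ p, f p ∂((guichardetMeasure lam).prod (guichardetMeasure lam)) := by
  change Integrable (fun ϑ : GS X ↦ ∑ S : Finset (Fin ϑ.1), f (splitAt S ϑ.2))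
      (guichardetMeasure lam) ∧
    ∫ ϑ : GS X, ∑ S : Finset (Fin ϑ.1), f (splitAt S ϑ.2) ∂(guichardetMeasure lam) = _
  rw [guichardetMeasure_prod_self_eq_sum_splitAt] at hf ⊢
  have hc (n : ℕ) : (n.factorial : ℝ≥0∞)⁻¹ ≠ 0 := by simp
  have hc' (n : ℕ) : (n.factorial : ℝ≥0∞)⁻¹ ≠ ∞ := by simp [Nat.factorial_ne_zero]
  obtain ⟨hfn, hsum⟩ := integrable_sum_measure_iff.1 hf
  have hgn (n : ℕ) := integrable_sum_splitAt lam (hc n) (hc' n) (hfn n)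
  have hle (n : ℕ) := integral_norm_sum_splitAt_le lam (hc n) (hc' n) (hfn n)
  rw [guichardetMeasure]
  have hg := integrable_sum_measure hgn
    (hsum.of_nonneg_of_le (fun n ↦ integral_nonneg fun _ ↦ norm_nonneg _) hle)
  refine ⟨hg, ?_⟩
  rw [integral_sum_measure hf, integral_sum_measure hg]
  exact tsum_congr fun n ↦ integral_sum_splitAt lam (hc n) (hc' n) (hfn n)
end
end

section
/- Let q₀, q₁ : X → [0,∞) be measurable, let n ∈ ℕ, and let F : (Fin n → X) → [0,∞] be measurable and symmetric (F(x ∘ σ) = F(x) for every permutation σ of Fin n). Then, in [0,∞], ∫ F(x) · ∏_{i} (q₀ + q₁)(x_i) dλ^{⊗n}(x) = ∑_{m=0}^{n} (n choose m) ∫_{(Fin m → X) × (Fin (n−m) → X)} F(y ⊕ z) · ∏_{i} q₀(y_i) · ∏_{j} q₁(z_j) d(λ^{⊗m} ⊗ λ^{⊗(n−m)})(y, z). -/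
open MeasureTheory ENNReal
open scoped NNReal

noncomputable section

/-- Listing two blocks of coordinates along an equivalence `e : ι ⊕ κ ≃ τ` maps the product of
the two product measures to the product measure over `τ`. -/
theorem measurePreserving_sumElim_comp_symm {X ι κ τ : Type*} [MeasurableSpace X]
    (lam : Measure X) [SigmaFinite lam] [Fintype ι] [Fintype κ] [Fintype τ] (e : ι ⊕ κ ≃ τ) :
    MeasurePreserving (fun yz : (ι → X) × (κ → X) => Sum.elim yz.1 yz.2 ∘ e.symm)
      ((Measure.pi fun _ => lam).prod (Measure.pi fun _ => lam)) (Measure.pi fun _ => lam) := by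
  have h := (measurePreserving_piCongrLeft (fun _ : τ => lam) e).comp
    (measurePreserving_sumPiEquivProdPi_symm (fun _ : ι ⊕ κ => lam))
  convert h using 1
  ext yz t
  obtain ⟨i, rfl⟩ := e.surjective t
  simp only [Function.comp_apply, Equiv.symm_apply_apply]
  erw [MeasurableEquiv.piCongrLeft_apply_apply]
  cases i <;> rfl

/-- Every term of the expanded product weight is integrated, by symmetry, as if its `q₀`-block
came first. -/
theorem lintegral_symmetric_mul_prod_mul_prod_compl {X : Type*} [MeasurableSpace X]
    (lam : Measure X) [SigmaFinite lam]
    {q₀ q₁ : X → ℝ≥0∞} (hq₀ : Measurable q₀) (hq₁ : Measurable q₁)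
    {n m k : ℕ} {F : (Fin n → X) → ℝ≥0∞} (hF : Measurable F)
    (hFs : ∀ (σ : Equiv.Perm (Fin n)) (x : Fin n → X), F (x ∘ σ) = F x)
    (t : Finset (Fin n)) (hm : t.card = m) (hk : tᶜ.card = k) (hmk : n = m + k) :
    ∫⁻ x, F x * ((∏ i ∈ t, q₀ (x i)) * ∏ i ∈ tᶜ, q₁ (x i)) ∂(Measure.pi fun _ => lam)
      = ∫⁻ yz : (Fin m → X) × (Fin k → X),
          F (Fin.append yz.1 yz.2 ∘ Fin.cast hmk) * (∏ i, q₀ (yz.1 i)) * (∏ j, q₁ (yz.2 j))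
            ∂((Measure.pi fun _ => lam).prod (Measure.pi fun _ => lam)) := by
  set e := finSumEquivOfFinset hm hk with he
  rw [← (measurePreserving_sumElim_comp_symm lam e).lintegral_comp (by fun_prop)]
  refine lintegral_congr fun yz => ?_
  have hF' : F (Sum.elim yz.1 yz.2 ∘ e.symm) = F (Fin.append yz.1 yz.2 ∘ Fin.cast hmk) := by
    rw [← hFs (((finCongr hmk).trans finSumFinEquiv.symm).trans e)]
    congr 1
    funext i
    obtain ⟨j, rfl⟩ := (finCongr hmk).symm.surjective i
    obtain ⟨j | j, rfl⟩ := finSumFinEquiv.surjective j <;> simp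
  have h₀ : ∏ i ∈ t, q₀ ((Sum.elim yz.1 yz.2 ∘ e.symm) i) = ∏ i, q₀ (yz.1 i) := by
    rw [← t.prod_coe_sort, ← (t.orderIsoOfFin hm).toEquiv.prod_comp]
    refine Finset.prod_congr rfl fun i _ => ?_
    have : ((t.orderIsoOfFin hm).toEquiv i : Fin n) = e (Sum.inl i) := by simp [he]
    rw [this]
    simp
  have h₁ : ∏ i ∈ tᶜ, q₁ ((Sum.elim yz.1 yz.2 ∘ e.symm) i) = ∏ i, q₁ (yz.2 i) := by
    rw [← tᶜ.prod_coe_sort, ← (tᶜ.orderIsoOfFin hk).toEquiv.prod_comp]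
    refine Finset.prod_congr rfl fun i _ => ?_
    have : ((tᶜ.orderIsoOfFin hk).toEquiv i : Fin n) = e (Sum.inr i) := by simp [he]
    rw [this]
    simp
  rw [hF', h₀, h₁, mul_assoc]

/-- Binomial expansion of a product weight under the symmetric integral:
`∫ F·(q₀+q₁)^⊗ dλ^{⊗n} = ∑ₘ (n choose m) ∬ F(y⊕z)·q₀^⊗(y)·q₁^⊗(z) d(λ^{⊗m} ⊗ λ^{⊗(n−m)})`. -/
theorem stmt4 {X : Type*} [MeasurableSpace X] (lam : Measure X) [SigmaFinite lam]
    (q₀ q₁ : X → ℝ≥0) (hq₀ : Measurable q₀) (hq₁ : Measurable q₁)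
    (n : ℕ) (F : (Fin n → X) → ℝ≥0∞) (hF : Measurable F)
    (hFs : ∀ (σ : Equiv.Perm (Fin n)) (x : Fin n → X), F (x ∘ σ) = F x) :
    ∫⁻ x : Fin n → X, F x * ∏ i : Fin n, ((q₀ (x i) : ℝ≥0∞) + (q₁ (x i) : ℝ≥0∞))
        ∂(Measure.pi fun _ : Fin n => lam)
      = ∑ m : Fin (n + 1),
          (n.choose m : ℝ≥0∞) *
            ∫⁻ yz : (Fin (m : ℕ) → X) × (Fin (n - (m : ℕ)) → X),
              F (Fin.append yz.1 yz.2 ∘ Fin.cast (Nat.add_sub_cancel' m.is_le).symm) *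
                (∏ i : Fin (m : ℕ), (q₀ (yz.1 i) : ℝ≥0∞)) *
                (∏ j : Fin (n - (m : ℕ)), (q₁ (yz.2 j) : ℝ≥0∞))
            ∂((Measure.pi fun _ : Fin (m : ℕ) => lam).prod
                (Measure.pi fun _ : Fin (n - (m : ℕ)) => lam)) := by
  have hcard (m : Fin (n + 1)) : (n.choose m : ℝ≥0∞) =
      ((Finset.univ.filter fun t : Finset (Fin n) => t.card = m).card : ℝ≥0∞) := by
    rw [← Finset.powerset_univ, ← Finset.powersetCard_eq_filter, Finset.card_powersetCard,
      Finset.card_univ, Fintype.card_fin]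
  have hlt (t : Finset (Fin n)) : t.card < n + 1 :=
    Nat.lt_succ_of_le (t.card_le_univ.trans_eq (Fintype.card_fin n))
  simp_rw [Finset.prod_add, Finset.powerset_univ, Finset.mul_sum, ← Finset.compl_eq_univ_sdiff]
  rw [lintegral_finsetSum _ (by fun_prop),
    ← Finset.sum_fiberwise Finset.univ (fun t : Finset (Fin n) => (⟨t.card, hlt t⟩ : Fin (n + 1)))]
  refine Finset.sum_congr rfl fun m _ => ?_
  rw [hcard, ← nsmul_eq_mul]
  simp only [Fin.ext_iff]
  refine Finset.sum_eq_card_nsmul fun t ht => ?_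
  have hm : t.card = m := (Finset.mem_filter.mp ht).2
  exact lintegral_symmetric_mul_prod_mul_prod_compl lam hq₀.coe_nnreal_ennreal
    hq₁.coe_nnreal_ennreal hF hFs t hm (by simp [Finset.card_compl, hm]) _
end
end

section
/- Let n ∈ ℕ, let q₀, q₁ : X → (0,∞) be measurable, let f : (Fin n → X) → ℂ be measurable and symmetric, and let χ : Ω → H be measurable and symmetric. Define the n-th order Skorokhod integral S_n(f)χ : Ω → H by (S_n(f)χ)(N, x) = ∑_{S ⊆ Fin N, |S| = n} f(x|_S) · χ(N − n, x|_{S^c}) for N ≥ n, and 0 for N < n. Then (∫_Ω ‖(S_n(f)χ)(ϑ)‖² ((q₀ + q₁)⁻¹)^⊗(ϑ) dμ(ϑ))^{1/2} ≤ ((1/n!) ∫ |f(y)|² ∏_{i} q₀(y_i)⁻¹ dλ^{⊗n}(y))^{1/2} · (∫_Ω ‖χ(ϑ)‖² (q₁⁻¹)^⊗(ϑ) dμ(ϑ))^{1/2}. -/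
open MeasureTheory ENNReal
open scoped NNReal

noncomputable section

/-- The product weight `q^⊗(n,x) = ∏ᵢ q(xᵢ)`. -/
def prodWeight {X : Type*} (q : X → ℝ≥0) (ϑ : GS X) : ℝ≥0∞ :=
  ∏ i : Fin ϑ.1, (q (ϑ.2 i) : ℝ≥0∞)

/-- A function on the Guichardet space is symmetric if it is invariant under permutations
of the coordinates. -/
def SymmFun {X E : Type*} (χ : GS X → E) : Prop :=
  ∀ (n : ℕ) (σ : Equiv.Perm (Fin n)) (x : Fin n → X), χ ⟨n, x ∘ σ⟩ = χ ⟨n, x⟩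

/-- The `n`-th order Skorokhod integral
`(Sₙ(f)χ)(N,x) = ∑_{S ⊆ Fin N, |S| = n} f(x|_S) • χ(N−n, x|_{Sᶜ})`. -/
def skorokhod {X H : Type*} [NormedAddCommGroup H] [Module ℂ H] (n : ℕ)
    (f : (Fin n → X) → ℂ) (χ : GS X → H) (ϑ : GS X) : H :=
  ∑ S : Finset (Fin ϑ.1),
    if h : S.card = n then
      f (restrOf S h ϑ.2) • χ ⟨ϑ.1 - n, restrOf Sᶜ (by simp [Finset.card_compl, h]) ϑ.2⟩
    else 0

section Restriction

variable {X : Type*} {N n m : ℕ}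

lemma prod_restrOf {M : Type*} [CommMonoid M] (S : Finset (Fin N)) (hS : S.card = n)
    (x : Fin N → X) (g : X → M) : ∏ i, g (restrOf S hS x i) = ∏ i ∈ S, g (x i) := by
  rw [← Finset.prod_coe_sort S]
  exact Equiv.prod_comp (S.orderIsoOfFin hS).toEquiv fun i : S => g (x i)

/-- Splitting the coordinates along `S` and `Sᶜ` preserves the product measures. -/
lemma measurePreserving_restrOf_prodMk [MeasurableSpace X] (lam : Measure X) [SigmaFinite lam]
    (S : Finset (Fin N)) (hS : S.card = n) (hSc : Sᶜ.card = m) :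
    MeasurePreserving (fun x : Fin N → X => (restrOf S hS x, restrOf Sᶜ hSc x))
      (Measure.pi fun _ => lam)
      ((Measure.pi fun _ : Fin n => lam).prod (Measure.pi fun _ : Fin m => lam)) :=
  (measurePreserving_sumPiEquivProdPi fun _ : Fin n ⊕ Fin m => lam).comp
    (measurePreserving_piCongrLeft (fun _ : Fin N => lam) (finSumEquivOfFinset hS hSc)).symm

lemma lintegral_restrOf_mul_restrOf_compl [MeasurableSpace X] (lam : Measure X)
    [SigmaFinite lam] (S : Finset (Fin N)) (hS : S.card = n) (hSc : Sᶜ.card = m)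
    {F : (Fin n → X) → ℝ≥0∞} {G : (Fin m → X) → ℝ≥0∞} (hF : Measurable F) (hG : Measurable G) :
    ∫⁻ x, F (restrOf S hS x) * G (restrOf Sᶜ hSc x) ∂(Measure.pi fun _ : Fin N => lam)
      = (∫⁻ y, F y ∂(Measure.pi fun _ => lam)) * ∫⁻ z, G z ∂(Measure.pi fun _ => lam) := by
  rw [← lintegral_prod_mul hF.aemeasurable hG.aemeasurable]
  exact (measurePreserving_restrOf_prodMk lam S hS hSc).lintegral_comp
    (f := fun z : (Fin n → X) × (Fin m → X) => F z.1 * G z.2) (by fun_prop)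

end Restriction

lemma measurable_guichardet_mk {X : Type*} [MeasurableSpace X] (n : ℕ) :
    Measurable (fun x : Fin n → X => (⟨n, x⟩ : GS X)) :=
  Measurable.of_le_map (iInf_le _ n)

lemma lintegral_guichardetMeasure {X : Type*} [MeasurableSpace X] (lam : Measure X)
    {g : GS X → ℝ≥0∞} (hg : Measurable g) :
    ∫⁻ ϑ, g ϑ ∂(guichardetMeasure lam) =
      ∑' n : ℕ, (n.factorial : ℝ≥0∞)⁻¹ *
        ∫⁻ x, g ⟨n, x⟩ ∂(Measure.pi fun _ : Fin n => lam) := by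
  simp_rw [guichardetMeasure, lintegral_sum_measure, lintegral_smul_measure, smul_eq_mul,
    lintegral_map hg (measurable_guichardet_mk _)]

lemma lintegral_guichardetMeasure_le {X : Type*} [MeasurableSpace X] (lam : Measure X)
    (g : GS X → ℝ≥0∞) :
    ∫⁻ ϑ, g ϑ ∂(guichardetMeasure lam) ≤
      ∑' n : ℕ, (n.factorial : ℝ≥0∞)⁻¹ *
        ∫⁻ x, g ⟨n, x⟩ ∂(Measure.pi fun _ : Fin n => lam) := by
  simp_rw [guichardetMeasure, lintegral_sum_measure, lintegral_smul_measure, smul_eq_mul]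
  gcongr
  exact lintegral_map_le _ _

/-- Weighted Cauchy–Schwarz over subsets, with the weights `∏_S a · ∏_{Sᶜ} b` that sum up to
`∏ (a + b)`. -/
lemma sq_sum_mul_prod_add_inv_le {ι : Type*} [Fintype ι] [DecidableEq ι] {a b : ι → ℝ≥0}
    (ha : ∀ i, 0 < a i) (hb : ∀ i, 0 < b i) (r : Finset ι → ℝ≥0) :
    (∑ S, r S) ^ 2 * ∏ i, (a i + b i)⁻¹ ≤
      ∑ S, r S ^ 2 * ((∏ i ∈ S, (a i)⁻¹) * ∏ i ∈ Sᶜ, (b i)⁻¹) := by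
  have hpos : 0 < ∏ i, (a i + b i) := Finset.prod_pos fun i _ => add_pos (ha i) (hb i)
  have hw : ∏ i, (a i + b i) = ∑ S : Finset ι, (∏ i ∈ S, a i) * ∏ i ∈ Sᶜ, b i := by
    rw [Finset.prod_add, Finset.powerset_univ]
    simp_rw [Finset.compl_eq_univ_sdiff]
  rw [Finset.prod_inv_distrib, ← div_eq_mul_inv, div_le_iff₀ hpos, hw, mul_comm]
  refine Finset.sum_sq_le_sum_mul_sum_of_sq_le_mul _ (fun _ _ => zero_le) (fun _ _ => zero_le)
    fun S _ => le_of_eq ?_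
  have h1 : ∏ i ∈ S, a i ≠ 0 := (Finset.prod_pos fun i _ => ha i).ne'
  have h2 : ∏ i ∈ Sᶜ, b i ≠ 0 := (Finset.prod_pos fun i _ => hb i).ne'
  rw [Finset.prod_inv_distrib, Finset.prod_inv_distrib]
  field_simp

lemma nnnorm_skorokhod_sq_mul_le {X H : Type*} [NormedAddCommGroup H] [NormedSpace ℂ H] (n : ℕ)
    {q₀ q₁ : X → ℝ≥0} (hq₀ : ∀ x, 0 < q₀ x) (hq₁ : ∀ x, 0 < q₁ x)
    (f : (Fin n → X) → ℂ) (χ : GS X → H) (N : ℕ) (x : Fin N → X) :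
    ‖skorokhod n f χ ⟨N, x⟩‖₊ ^ 2 * ∏ i, (q₀ (x i) + q₁ (x i))⁻¹ ≤
      ∑ S : Finset (Fin N), if h : S.card = n then
        (‖f (restrOf S h x)‖₊ ^ 2 * ∏ i, (q₀ (restrOf S h x i))⁻¹) *
        (‖χ ⟨N - n, restrOf Sᶜ (by simp [Finset.card_compl, h]) x⟩‖₊ ^ 2 *
          ∏ i, (q₁ (restrOf Sᶜ (m := N - n) (by simp [Finset.card_compl, h]) x i))⁻¹)
      else 0 := by
  have hnorm := nnnorm_sum_le (Finset.univ : Finset (Finset (Fin N))) fun S =>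
    if h : S.card = n then
      f (restrOf S h x) • χ ⟨N - n, restrOf Sᶜ (by simp [Finset.card_compl, h]) x⟩
    else 0
  refine (mul_le_mul_left (pow_le_pow_left₀ zero_le hnorm 2) _).trans ?_
  refine (sq_sum_mul_prod_add_inv_le (fun i => hq₀ (x i)) (fun i => hq₁ (x i)) _).trans_eq ?_
  refine Finset.sum_congr rfl fun S _ => ?_
  split_ifs with h
  · rw [prod_restrOf S h x fun y => (q₀ y)⁻¹, prod_restrOf Sᶜ _ x fun y => (q₁ y)⁻¹, nnnorm_smul]
    ring
  · simp

lemma choose_mul_inv_factorial_add (n k : ℕ) :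
    ((k + n).factorial : ℝ≥0∞)⁻¹ * ((k + n).choose n : ℝ≥0∞) =
      (n.factorial : ℝ≥0∞)⁻¹ * (k.factorial : ℝ≥0∞)⁻¹ := by
  have hfac (j : ℕ) : (j.factorial : ℝ≥0) ≠ 0 := by exact_mod_cast j.factorial_ne_zero
  have key : ((k + n).factorial : ℝ≥0)⁻¹ * ((k + n).choose n : ℝ≥0) =
      (n.factorial : ℝ≥0)⁻¹ * (k.factorial : ℝ≥0)⁻¹ := by
    have h : ((k + n).choose n * n.factorial * k.factorial : ℝ≥0) = (k + n).factorial := by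
      exact_mod_cast (by simpa using Nat.choose_mul_factorial_mul_factorial (Nat.le_add_left n k))
    have := hfac (k + n)
    have := hfac n
    have := hfac k
    field_simp
    linear_combination h
  have := congrArg (fun t : ℝ≥0 => (t : ℝ≥0∞)) key
  simpa [ENNReal.coe_mul, ENNReal.coe_inv, hfac] using this

lemma lintegral_nnnorm_skorokhod_sq_mul_le {X : Type*} [MeasurableSpace X] (lam : Measure X)
    [SigmaFinite lam] {H : Type*} [NormedAddCommGroup H] [NormedSpace ℂ H] [MeasurableSpace H]
    [BorelSpace H] (n : ℕ) {q₀ q₁ : X → ℝ≥0} (hq₀ : Measurable q₀) (hq₁ : Measurable q₁)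
    (hq₀pos : ∀ x, 0 < q₀ x) (hq₁pos : ∀ x, 0 < q₁ x)
    {f : (Fin n → X) → ℂ} (hf : Measurable f) {χ : GS X → H} (hχ : Measurable χ) (N : ℕ) :
    ∫⁻ x, (‖skorokhod n f χ ⟨N, x⟩‖₊ : ℝ≥0∞) ^ 2 *
        prodWeight (fun x => (q₀ x + q₁ x)⁻¹) ⟨N, x⟩ ∂(Measure.pi fun _ : Fin N => lam) ≤
      N.choose n * ((∫⁻ y, ((‖f y‖₊ ^ 2 * ∏ i, (q₀ (y i))⁻¹ : ℝ≥0) : ℝ≥0∞)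
          ∂(Measure.pi fun _ : Fin n => lam)) *
        ∫⁻ z, ((‖χ ⟨N - n, z⟩‖₊ ^ 2 * ∏ i, (q₁ (z i))⁻¹ : ℝ≥0) : ℝ≥0∞)
          ∂(Measure.pi fun _ : Fin (N - n) => lam)) := by
  set F : (Fin n → X) → ℝ≥0∞ := fun y => ((‖f y‖₊ ^ 2 * ∏ i, (q₀ (y i))⁻¹ : ℝ≥0) : ℝ≥0∞)
  set G : (Fin (N - n) → X) → ℝ≥0∞ := fun z =>
    ((‖χ ⟨N - n, z⟩‖₊ ^ 2 * ∏ i, (q₁ (z i))⁻¹ : ℝ≥0) : ℝ≥0∞)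
  have hF : Measurable F := by fun_prop
  have hG : Measurable G := by
    have hχk : Measurable fun z : Fin (N - n) → X => χ ⟨N - n, z⟩ :=
      hχ.comp (measurable_guichardet_mk _)
    have hw : Measurable fun z : Fin (N - n) → X => ∏ i, (q₁ (z i))⁻¹ := by fun_prop
    exact ((hχk.nnnorm.pow_const 2).mul hw).coe_nnreal_ennreal
  have hres (m : ℕ) (S : Finset (Fin N)) (h : S.card = m) :
      Measurable (fun x : Fin N → X => restrOf S h x) :=
    measurable_pi_lambda _ fun i => measurable_pi_apply _
  calc _ ≤ ∫⁻ x, ∑ S : Finset (Fin N), (if h : S.card = n then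
            F (restrOf S h x) * G (restrOf Sᶜ (by simp [Finset.card_compl, h]) x) else 0)
          ∂(Measure.pi fun _ : Fin N => lam) := by
        refine lintegral_mono fun x => ?_
        have h := ENNReal.coe_le_coe.2 (nnnorm_skorokhod_sq_mul_le n hq₀pos hq₁pos f χ N x)
        rw [ENNReal.coe_mul, ENNReal.coe_pow, ENNReal.ofNNReal_finsetProd, ENNReal.ofNNReal_finsetSum] at h
        refine h.trans_eq (Finset.sum_congr rfl fun S _ => ?_)
        split_ifs
        · exact ENNReal.coe_mul _ _
        · rfl
    _ = ∑ S : Finset (Fin N), if S.card = n then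
          (∫⁻ y, F y ∂(Measure.pi fun _ => lam)) * ∫⁻ z, G z ∂(Measure.pi fun _ => lam)
          else 0 := by
        rw [lintegral_finsetSum]
        · refine Finset.sum_congr rfl fun S _ => ?_
          split_ifs with h
          · exact lintegral_restrOf_mul_restrOf_compl lam S h _ hF hG
          · simp
        · intro S _
          split_ifs with h
          · exact (hF.comp (hres _ S h)).mul (hG.comp (hres _ Sᶜ _))
          · exact measurable_const
    _ = _ := by
        rw [← Finset.sum_filter, Finset.sum_const, nsmul_eq_mul]
        congr 2
        have : (Finset.univ.filter fun S : Finset (Fin N) => S.card = n) =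
            Finset.powersetCard n Finset.univ := by
          ext S; simp [Finset.mem_powersetCard]
        rw [this, Finset.card_powersetCard, Finset.card_univ, Fintype.card_fin]

/-- The norm estimate for the `n`-th order Skorokhod integral. -/
theorem stmt7 {X : Type*} [MeasurableSpace X] (lam : Measure X) [SigmaFinite lam]
    {H : Type*} [NormedAddCommGroup H] [InnerProductSpace ℂ H] [MeasurableSpace H] [BorelSpace H]
    (n : ℕ) (q₀ q₁ : X → ℝ≥0) (hq₀ : Measurable q₀) (hq₁ : Measurable q₁)
    (hq₀pos : ∀ x, 0 < q₀ x) (hq₁pos : ∀ x, 0 < q₁ x)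
    (f : (Fin n → X) → ℂ) (hf : Measurable f)
    (hfs : ∀ (σ : Equiv.Perm (Fin n)) (y : Fin n → X), f (y ∘ σ) = f y)
    (χ : GS X → H) (hχ : Measurable χ) (hχs : SymmFun χ) :
    (∫⁻ ϑ : GS X, (‖skorokhod n f χ ϑ‖₊ : ℝ≥0∞) ^ 2 *
          prodWeight (fun x => (q₀ x + q₁ x)⁻¹) ϑ ∂(guichardetMeasure lam)) ^ (1/2 : ℝ)
      ≤ ((n.factorial : ℝ≥0∞)⁻¹ *
            ∫⁻ y : Fin n → X, (‖f y‖₊ : ℝ≥0∞) ^ 2 * ∏ i : Fin n, ((q₀ (y i))⁻¹ : ℝ≥0∞)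
              ∂(Measure.pi fun _ : Fin n => lam)) ^ (1/2 : ℝ) *
          (∫⁻ ϑ : GS X, (‖χ ϑ‖₊ : ℝ≥0∞) ^ 2 * prodWeight (fun x => (q₁ x)⁻¹) ϑ
              ∂(guichardetMeasure lam)) ^ (1/2 : ℝ) := by
  rw [← ENNReal.mul_rpow_of_nonneg _ _ (by norm_num)]
  refine ENNReal.rpow_le_rpow ?_ (by norm_num)
  have hF : (∫⁻ y : Fin n → X, (‖f y‖₊ : ℝ≥0∞) ^ 2 * ∏ i : Fin n, ((q₀ (y i))⁻¹ : ℝ≥0∞)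
      ∂(Measure.pi fun _ : Fin n => lam)) =
      ∫⁻ y, ((‖f y‖₊ ^ 2 * ∏ i, (q₀ (y i))⁻¹ : ℝ≥0) : ℝ≥0∞)
          ∂(Measure.pi fun _ : Fin n => lam) := by
    refine lintegral_congr fun y => ?_
    simp only [ENNReal.coe_mul, ENNReal.coe_pow, ENNReal.ofNNReal_finsetProd,
      ENNReal.coe_inv (hq₀pos _).ne']
  have hweight : Measurable (prodWeight fun x => (q₁ x)⁻¹) := by
    refine fun s hs => MeasurableSpace.measurableSet_iInf.2 fun k => ?_
    have : Measurable fun x : Fin k → X => ∏ i, (((q₁ (x i))⁻¹ : ℝ≥0) : ℝ≥0∞) := by fun_prop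
    exact this hs
  have hG := lintegral_guichardetMeasure lam
    (g := fun ϑ => (‖χ ϑ‖₊ : ℝ≥0∞) ^ 2 * prodWeight (fun x => (q₁ x)⁻¹) ϑ) (by fun_prop)
  rw [hF, hG]
  set A := ∫⁻ y, ((‖f y‖₊ ^ 2 * ∏ i, (q₀ (y i))⁻¹ : ℝ≥0) : ℝ≥0∞)
          ∂(Measure.pi fun _ : Fin n => lam)
  set B : ℕ → ℝ≥0∞ := fun k => ∫⁻ z, ((‖χ ⟨k, z⟩‖₊ ^ 2 * ∏ i, (q₁ (z i))⁻¹ : ℝ≥0) : ℝ≥0∞)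
          ∂(Measure.pi fun _ : Fin k => lam)
  calc _ ≤ ∑' N : ℕ, (N.factorial : ℝ≥0∞)⁻¹ * (N.choose n * (A * B (N - n))) := by
        refine (lintegral_guichardetMeasure_le lam _).trans ?_
        gcongr with N
        exact lintegral_nnnorm_skorokhod_sq_mul_le lam n hq₀ hq₁ hq₀pos hq₁pos hf hχ N
    _ = ∑' k : ℕ, ((k + n).factorial : ℝ≥0∞)⁻¹ * ((k + n).choose n * (A * B k)) := by
        rw [← ENNReal.summable.sum_add_tsum_nat_add' (k := n), Finset.sum_eq_zero, zero_add]
        · simp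
        · intro N hN
          simp [Nat.choose_eq_zero_of_lt (Finset.mem_range.1 hN)]
    _ = ∑' k : ℕ, ((n.factorial : ℝ≥0∞)⁻¹ * A) * ((k.factorial : ℝ≥0∞)⁻¹ * B k) := by
        refine tsum_congr fun k => ?_
        rw [← mul_assoc, choose_mul_inv_factorial_add]
        ring
    _ = _ := by
        rw [ENNReal.tsum_mul_left]
        congr 1
        refine tsum_congr fun k => congrArg _ (lintegral_congr fun z => ?_)
        simp only [prodWeight, ENNReal.coe_mul, ENNReal.coe_pow, ENNReal.ofNNReal_finsetProd]
end
end

section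
/- Let g : X → ℂ, s : X → (0,∞) and q : X → [0,∞) be measurable, and let χ : Ω → H be measurable. Then the number (exchange) estimate ∫_Ω ‖(∑_{i : Fin n} g(x_i)) · χ(n, x)‖² q^⊗(n, x) dμ(n, x) ≤ (λ-ess sup_{x ∈ X} s(x)|g(x)|)² · ∫_Ω ‖χ(n, x)‖² ∏_{i} q(x_i)(1 + 1/s(x_i))² dμ(n, x) holds. -/
open MeasureTheory ENNReal
open scoped NNReal

noncomputable section

/-- A function on a sigma type is measurable as soon as its restrictions to all fibres are. -/
theorem measurable_sigma_of_fiber {ι β : Type*} {α : ι → Type*} [∀ i, MeasurableSpace (α i)]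
    [MeasurableSpace β] {f : (Σ i, α i) → β} (h : ∀ i, Measurable fun a => f ⟨i, a⟩) :
    Measurable f := fun _ ht =>
  MeasurableSpace.measurableSet_iInf.2 fun i => h i ht

theorem measurable_sigma_mk {ι : Type*} {α : ι → Type*} [∀ i, MeasurableSpace (α i)] (i : ι) :
    Measurable (Sigma.mk i : α i → Σ i, α i) := fun _ ht =>
  MeasurableSpace.measurableSet_iInf.1 ht i

theorem ENNReal.sum_le_prod_one_add {ι : Type*} (t : Finset ι) (a : ι → ℝ≥0∞) :
    ∑ i ∈ t, a i ≤ ∏ i ∈ t, (1 + a i) := by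
  classical
  induction t using Finset.induction_on with
  | empty => simp
  | insert j t hj ih =>
    rw [Finset.sum_insert hj, Finset.prod_insert hj, add_mul, one_mul, add_comm]
    exact add_le_add ih (le_mul_of_one_le_right' (Finset.one_le_prod' fun i _ => le_self_add))

/-- A property holding `lam`-almost everywhere holds at every point of almost every
configuration. -/
theorem ae_guichardetMeasure_forall {X : Type*} [MeasurableSpace X] (lam : Measure X)
    [SigmaFinite lam] {p : X → Prop} (hp : MeasurableSet {x | p x}) (h : ∀ᵐ x ∂lam, p x) :
    ∀ᵐ ϑ ∂(guichardetMeasure lam), ∀ i, p (ϑ.2 i) := by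
  have hset : MeasurableSet {ϑ : GS X | ∀ i, p (ϑ.2 i)} :=
    MeasurableSpace.measurableSet_iInf.2 fun n => by
      have hfib : MeasurableSet {x : Fin n → X | ∀ i, p (x i)} := by
        rw [Set.ofPred_forall]
        exact MeasurableSet.iInter fun i => measurable_pi_apply i hp
      exact hfib
  refine Measure.ae_sum_iff.2 fun n => Measure.ae_smul_measure ?_ _
  refine (ae_map_iff (measurable_sigma_mk n).aemeasurable hset).2 ?_
  exact ae_all_iff.2 fun i =>
    (Measure.tendsto_eval_ae_ae (μ := fun _ : Fin n => lam) (i := i)).eventually h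

/-- If `s |g| ≤ M` at all points, then `|∑ g| ≤ M ∏ (1 + 1/s)`. -/
theorem enorm_sum_le_mul_prod_one_add_inv {ι : Type*} [Fintype ι] (g : ι → ℂ) (s : ι → ℝ≥0)
    (hs : ∀ i, 0 < s i) {M : ℝ≥0∞} (h : ∀ i, (s i : ℝ≥0∞) * ‖g i‖ₑ ≤ M) :
    ‖∑ i, g i‖ₑ ≤ M * ∏ i, (1 + (s i : ℝ≥0∞)⁻¹) := by
  calc ‖∑ i, g i‖ₑ ≤ ∑ i, ‖g i‖ₑ := enorm_sum_le _ _
    _ ≤ ∑ i, M * (s i : ℝ≥0∞)⁻¹ := by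
        refine Finset.sum_le_sum fun i _ => ?_
        rw [← div_eq_mul_inv, ENNReal.le_div_iff_mul_le (by simp [(hs i).ne']) (by simp), mul_comm]
        exact h i
    _ = M * ∑ i, (s i : ℝ≥0∞)⁻¹ := (Finset.mul_sum _ _ _).symm
    _ ≤ M * ∏ i, (1 + (s i : ℝ≥0∞)⁻¹) := by
        gcongr
        exact ENNReal.sum_le_prod_one_add _ _

/-- The number (exchange) estimate for the operator of multiplication by `∑ᵢ g(xᵢ)`. -/
theorem stmt11 {X : Type*} [MeasurableSpace X] (lam : Measure X) [SigmaFinite lam]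
    {H : Type*} [NormedAddCommGroup H] [InnerProductSpace ℂ H] [MeasurableSpace H] [BorelSpace H]
    (g : X → ℂ) (hg : Measurable g)
    (s : X → ℝ≥0) (hs : Measurable s) (hspos : ∀ x, 0 < s x)
    (q : X → ℝ≥0) (hq : Measurable q)
    (χ : GS X → H) (hχ : Measurable χ) :
    ∫⁻ ϑ : GS X, (‖(∑ i : Fin ϑ.1, g (ϑ.2 i)) • χ ϑ‖₊ : ℝ≥0∞) ^ 2 * prodWeight q ϑ
        ∂(guichardetMeasure lam)
      ≤ (essSup (fun x => (s x : ℝ≥0∞) * (‖g x‖₊ : ℝ≥0∞)) lam) ^ 2 *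
          ∫⁻ ϑ : GS X, (‖χ ϑ‖₊ : ℝ≥0∞) ^ 2 *
              ∏ i : Fin ϑ.1, ((q (ϑ.2 i) : ℝ≥0∞) * (1 + ((s (ϑ.2 i) : ℝ≥0∞))⁻¹) ^ 2)
            ∂(guichardetMeasure lam) := by
  set M := essSup (fun x => (s x : ℝ≥0∞) * (‖g x‖₊ : ℝ≥0∞)) lam
  have hmeas : Measurable fun x => (s x : ℝ≥0∞) * (‖g x‖₊ : ℝ≥0∞) := by fun_prop
  have hae := ae_guichardetMeasure_forall lam (measurableSet_le hmeas measurable_const)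
    (ENNReal.ae_le_essSup (μ := lam) fun x => (s x : ℝ≥0∞) * (‖g x‖₊ : ℝ≥0∞))
  rw [← lintegral_const_mul]
  · refine lintegral_mono_ae ?_
    filter_upwards [hae] with ϑ hϑ
    have hsum := enorm_sum_le_mul_prod_one_add_inv (fun i => g (ϑ.2 i)) (fun i => s (ϑ.2 i))
      (fun i => hspos _) hϑ
    rw [nnnorm_smul, ENNReal.coe_mul, prodWeight, Finset.prod_mul_distrib, Finset.prod_pow]
    calc _ ≤ ((M * ∏ i, (1 + (s (ϑ.2 i) : ℝ≥0∞)⁻¹)) * ‖χ ϑ‖₊) ^ 2 * ∏ i, (q (ϑ.2 i) : ℝ≥0∞) := by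
          gcongr
          exact hsum
      _ = _ := by ring
  · refine Measurable.mul (by fun_prop) (measurable_sigma_of_fiber fun n => ?_)
    exact Finset.measurable_fun_prod (Finset.univ : Finset (Fin n))
      (f := fun i (x : Fin n → X) => (q (x i) : ℝ≥0∞) * (1 + (s (x i) : ℝ≥0∞)⁻¹) ^ 2)
      fun i _ => by fun_prop
end
end

section
/- Let d, f : X → ℂ be measurable with d·f λ-integrable, and let χ : Ω → H be measurable and symmetric. Define (a(d)χ)(ϑ) = ∫_X d(y) χ(ϑ ⊔ y) dλ(y) and (a†(f)χ)(n, x) = ∑_{i : Fin n} f(x_i) χ((n, x) ∖ i). Then for every ϑ ∈ Ω at which all the integrals and sums defining (a(d) a†(f) χ)(ϑ) and (a†(f) a(d) χ)(ϑ) converge absolutely, the Bosonic canonical commutation relation (a(d) a†(f) χ)(ϑ) − (a†(f) a(d) χ)(ϑ) = (∫_X d f dλ) · χ(ϑ) holds. (This is the I-adapted, i.e. usual adapted Bosonic, case Q = I of the commutation Corollary.) -/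
open MeasureTheory ENNReal
open scoped NNReal

noncomputable section

/-- `ϑ ⊔ y`: append `y` as last coordinate. -/
def GS.snoc {X : Type*} (ϑ : GS X) (y : X) : GS X := ⟨ϑ.1 + 1, Fin.snoc ϑ.2 y⟩

/-- `ϑ ∖ i`: remove the `i`-th coordinate. -/
def GS.erase {X : Type*} : (ϑ : GS X) → Fin ϑ.1 → GS X
  | ⟨_ + 1, x⟩, i => ⟨_, x ∘ i.succAbove⟩

/-- The annihilation operator `(a(d)χ)(ϑ) = ∫ d(y) χ(ϑ ⊔ y) dλ(y)`. -/
def annihilation {X H : Type*} [MeasurableSpace X] [NormedAddCommGroup H] [NormedSpace ℂ H]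
    (lam : Measure X) (d : X → ℂ) (χ : GS X → H) (ϑ : GS X) : H :=
  ∫ y, d y • χ (GS.snoc ϑ y) ∂lam

/-- The creation operator `(a†(f)χ)(n,x) = ∑ᵢ f(xᵢ) χ((n,x) ∖ i)`. -/
def creation {X H : Type*} [AddCommMonoid H] [Module ℂ H]
    (f : X → ℂ) (χ : GS X → H) (ϑ : GS X) : H :=
  ∑ i : Fin ϑ.1, f (ϑ.2 i) • χ (ϑ.erase i)

/-- Removing the appended coordinate recovers the original configuration. -/
theorem GS.erase_snoc_last {X : Type*} (ϑ : GS X) (y : X) :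
    (GS.snoc ϑ y).erase (Fin.last ϑ.1) = ϑ := by
  obtain ⟨n, x⟩ := ϑ
  simp only [GS.snoc, GS.erase]
  congr 1
  funext j
  simp [Fin.succAbove_last]

/-- Removing an old coordinate commutes with appending a new one. -/
theorem GS.erase_snoc_castSucc {X : Type*} (ϑ : GS X) (i : Fin ϑ.1) (y : X) :
    (GS.snoc ϑ y).erase i.castSucc = GS.snoc (ϑ.erase i) y := by
  obtain ⟨_ | n, x⟩ := ϑ
  · exact i.elim0
  · simp only [GS.snoc, GS.erase]
    congr 1
    funext j
    refine Fin.lastCases ?_ (fun j => ?_) j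
    · simp
    · simp

theorem creation_snoc {X H : Type*} [AddCommMonoid H] [Module ℂ H]
    (f : X → ℂ) (χ : GS X → H) (ϑ : GS X) (y : X) :
    creation f χ (GS.snoc ϑ y)
      = ∑ i : Fin ϑ.1, f (ϑ.2 i) • χ (GS.snoc (ϑ.erase i) y) + f y • χ ϑ := by
  refine (Fin.sum_univ_castSucc (n := ϑ.1) _).trans ?_
  congr 1
  · refine Finset.sum_congr rfl fun i _ => ?_
    rw [GS.erase_snoc_castSucc]
    simp [GS.snoc]
  · rw [GS.erase_snoc_last]
    simp [GS.snoc]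

/-- The Bosonic canonical commutation relation
`a(d)a†(f)χ − a†(f)a(d)χ = (∫ d f dλ)·χ`, pointwise at every `ϑ` where all the defining
integrals converge absolutely. -/
theorem stmt13 {X : Type*} [MeasurableSpace X] (lam : Measure X) [SigmaFinite lam]
    {H : Type*} [NormedAddCommGroup H] [InnerProductSpace ℂ H] [MeasurableSpace H] [BorelSpace H]
    [CompleteSpace H]
    (d f : X → ℂ) (hd : Measurable d) (hf : Measurable f)
    (hdf : Integrable (fun y => d y * f y) lam)
    (χ : GS X → H) (hχ : Measurable χ) (hχs : SymmFun χ)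
    (ϑ : GS X)
    (h₁ : Integrable (fun y => d y • creation f χ (GS.snoc ϑ y)) lam)
    (h₂ : ∀ i : Fin ϑ.1, Integrable (fun y => d y • χ (GS.snoc (ϑ.erase i) y)) lam) :
    annihilation lam d (creation f χ) ϑ - creation f (annihilation lam d χ) ϑ
      = (∫ y, d y * f y ∂lam) • χ ϑ := by
  have hsplit : ∀ y, d y • creation f χ (GS.snoc ϑ y)
      = ∑ i : Fin ϑ.1, f (ϑ.2 i) • (d y • χ (GS.snoc (ϑ.erase i) y)) + (d y * f y) • χ ϑ := by
    intro y
    rw [creation_snoc, smul_add, Finset.smul_sum, smul_smul]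
    simp only [smul_comm (d y)]
  have hsum : ∀ i ∈ (Finset.univ : Finset (Fin ϑ.1)),
      Integrable (fun y => f (ϑ.2 i) • (d y • χ (GS.snoc (ϑ.erase i) y))) lam :=
    fun i _ => (h₂ i).smul (f (ϑ.2 i))
  rw [annihilation, integral_congr_ae (.of_forall hsplit),
    integral_add (integrable_finsetSum _ hsum) (hdf.smul_const _), integral_finsetSum _ hsum,
    integral_smul_const]
  simp only [integral_smul, creation, annihilation, add_sub_cancel_left]
end
end
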